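/- Assume there exist τ* ≥ 1 with C_t = μ² for every t ≥ τ* (finite full mixing time) and B with Var(S_τ) ≤ B for every τ ≥ 0. Then Var(u(x_0,x_1)) + 2·∑_{k=0}^{τ*−1} (C_k − μ²) = 0, and the variance of the integrated transport saturates: Var(S_τ) = Var(S_{τ*}) for every τ ≥ τ*. -/

import Mathlib

open Finset

/-- Expectation with respect to the stationary path measure of length `τ`
(paths have `τ + 1` states). -/
noncomputable def pathE {S : Type*} [Fintype S] (P : S → S → ℝ) (pi : S → ℝ) (τ : ℕ)
    (f : (Fin (τ + 1) → S) → ℝ) : ℝ :=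
  ∑ x : Fin (τ + 1) → S,
    (pi (x 0) * ∏ t : Fin τ, P (x t.castSucc) (x t.succ)) * f x

/-- Integrated transport `S_τ = ∑_{t=1}^{τ} u (x_{t-1}, x_t)` along a path. -/
noncomputable def intTrans {S : Type*} (u : S → S → ℝ) (τ : ℕ) (x : Fin (τ + 1) → S) : ℝ :=
  ∑ t : Fin τ, u (x t.castSucc) (x t.succ)

/-- Stationary mean `μ = E[u (x₀, x₁)]`. -/
noncomputable def mu {S : Type*} [Fintype S] (P : S → S → ℝ) (pi : S → ℝ)
    (u : S → S → ℝ) : ℝ :=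
  pathE P pi 1 fun x => u (x 0) (x 1)

/-- Time correlator `C_k = E[u (x₀, x₁) · u (x_{k+1}, x_{k+2})]`. -/
noncomputable def corr {S : Type*} [Fintype S] (P : S → S → ℝ) (pi : S → ℝ)
    (u : S → S → ℝ) (k : ℕ) : ℝ :=
  pathE P pi (k + 2) fun x =>
    u (x 0) (x 1) * u (x ⟨k + 1, by omega⟩) (x ⟨k + 2, by omega⟩)

/-- Variance of the integrated transport `Var(S_τ)`. -/
noncomputable def varS {S : Type*} [Fintype S] (P : S → S → ℝ) (pi : S → ℝ)
    (u : S → S → ℝ) (τ : ℕ) : ℝ :=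
  pathE P pi τ (fun x => (intTrans u τ x) ^ 2)
    - (pathE P pi τ (fun x => intTrans u τ x)) ^ 2

lemma intTrans_succ_eq_init {S : Type*} (u : S → S → ℝ) (n : ℕ) (x : Fin (n + 2) → S) :
    intTrans u (n + 1) x = intTrans u n (fun i => x i.castSucc)
      + u (x (Fin.last n).castSucc) (x (Fin.last n).succ) := by
  simp only [intTrans, Fin.sum_univ_castSucc, Fin.castSucc_succ]

lemma intTrans_succ_eq_tail {S : Type*} (u : S → S → ℝ) (n : ℕ) (x : Fin (n + 2) → S) :
    intTrans u (n + 1) x = u (x 0) (x 1) + intTrans u n (fun i => x i.succ) := by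
  simp only [intTrans, Fin.sum_univ_succ, Fin.succ_castSucc, Fin.castSucc_zero,
    Fin.succ_zero_eq_one]

section PathExpectation

variable {S : Type*} [Fintype S] {P : S → S → ℝ} {pi : S → ℝ}

lemma pathE_add (n : ℕ) (f g : (Fin (n + 1) → S) → ℝ) :
    pathE P pi n (fun x => f x + g x) = pathE P pi n f + pathE P pi n g := by
  simp only [pathE, mul_add, Finset.sum_add_distrib]

lemma pathE_const_mul (n : ℕ) (c : ℝ) (f : (Fin (n + 1) → S) → ℝ) :
    pathE P pi n (fun x => c * f x) = c * pathE P pi n f := by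
  simp only [pathE, Finset.mul_sum]
  exact Finset.sum_congr rfl fun x _ => by ring

lemma pathE_nonneg (hP : ∀ r r', 0 ≤ P r r') (hpi : ∀ r, 0 ≤ pi r) (n : ℕ)
    (f : (Fin (n + 1) → S) → ℝ) (hf : ∀ x, 0 ≤ f x) : 0 ≤ pathE P pi n f :=
  Finset.sum_nonneg fun x _ =>
    mul_nonneg (mul_nonneg (hpi _) (Finset.prod_nonneg fun _ _ => hP _ _)) (hf x)

/-- Forgetting the final state of a path preserves the path measure. -/
lemma pathE_init (hProw : ∀ r, ∑ r', P r r' = 1) (n : ℕ) (f : (Fin (n + 1) → S) → ℝ) :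
    pathE P pi (n + 1) (fun x => f (fun i => x i.castSucc)) = pathE P pi n f := by
  unfold pathE
  rw [← (Fin.snocEquiv (fun _ : Fin (n + 2) => S)).sum_comp, Fintype.sum_prod_type_right]
  refine Finset.sum_congr rfl fun y _ => ?_
  have key : ∀ s : S, Fin.snocEquiv (fun _ : Fin (n + 2) => S) (s, y)
      = Fin.snoc (α := fun _ => S) y s := fun s => rfl
  have h0 : ∀ s : S, Fin.snoc (α := fun _ => S) y s 0 = y 0 := fun s =>
    Fin.snoc_castSucc (α := fun _ => S) s y 0
  simp only [key, Fin.prod_univ_castSucc, Fin.snoc_castSucc, h0, Fin.succ_last, Fin.snoc_last,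
    ← Fin.castSucc_succ]
  calc _ = ∑ s, (pi (y 0) * ∏ t : Fin n, P (y t.castSucc) (y t.succ)) * f y
          * P (y (Fin.last n)) s := Finset.sum_congr rfl fun s _ => by ring
    _ = _ := by rw [← Finset.mul_sum, hProw, mul_one]

/-- Forgetting the initial state of a path preserves the stationary path measure. -/
lemma pathE_tail (hstat : ∀ r', ∑ r, pi r * P r r' = pi r') (n : ℕ)
    (f : (Fin (n + 1) → S) → ℝ) :
    pathE P pi (n + 1) (fun x => f (fun i => x i.succ)) = pathE P pi n f := by
  unfold pathE
  rw [← (Fin.consEquiv (fun _ : Fin (n + 2) => S)).sum_comp, Fintype.sum_prod_type_right]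
  refine Finset.sum_congr rfl fun y _ => ?_
  have key : ∀ s : S, Fin.consEquiv (fun _ : Fin (n + 2) => S) (s, y)
      = Fin.cons (α := fun _ => S) s y := fun s => rfl
  simp only [key, Fin.prod_univ_succ, Fin.cons_succ, Fin.cons_zero, Fin.castSucc_zero,
    ← Fin.succ_castSucc]
  calc _ = ∑ s, pi s * P s (y 0) * ((∏ t : Fin n, P (y t.castSucc) (y t.succ)) * f y) :=
          Finset.sum_congr rfl fun s _ => by ring
    _ = _ := by rw [← Finset.sum_mul, hstat, mul_assoc]

lemma pathE_one (hProw : ∀ r, ∑ r', P r r' = 1) (hpisum : ∑ r, pi r = 1) (n : ℕ) :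
    pathE P pi n (fun _ => 1) = 1 := by
  induction n with
  | zero =>
    rw [pathE, ← (Equiv.funUnique (Fin 1) S).symm.sum_comp]
    simpa using hpisum
  | succ n ih => exact (pathE_init hProw n fun _ => 1).trans ih

lemma pathE_sq_sub_sq_nonneg (hP : ∀ r r', 0 ≤ P r r') (hpi : ∀ r, 0 ≤ pi r)
    (hProw : ∀ r, ∑ r', P r r' = 1) (hpisum : ∑ r, pi r = 1) (n : ℕ)
    (f : (Fin (n + 1) → S) → ℝ) :
    0 ≤ pathE P pi n (fun x => f x ^ 2) - pathE P pi n f ^ 2 := by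
  set m := pathE P pi n f with hm
  have h : pathE P pi n (fun x => (f x - m) ^ 2)
      = pathE P pi n (fun x => f x ^ 2) - m ^ 2 := by
    have : (fun x => (f x - m) ^ 2) = fun x => f x ^ 2 + ((-2 * m) * f x + m ^ 2 * 1) := by
      funext x; ring
    rw [this, pathE_add, pathE_add, pathE_const_mul, pathE_const_mul, pathE_one hProw hpisum,
      ← hm]
    ring
  rw [← h]
  exact pathE_nonneg hP hpi n _ fun x => sq_nonneg _

/-- By stationarity, an observable of the last step has the law of the first step. -/
lemma pathE_last_step (hstat : ∀ r', ∑ r, pi r * P r r' = pi r') (g : S → S → ℝ) (n : ℕ) :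
    pathE P pi (n + 1) (fun x => g (x (Fin.last n).castSucc) (x (Fin.last n).succ))
      = pathE P pi 1 (fun x => g (x 0) (x 1)) := by
  induction n with
  | zero => rfl
  | succ n ih =>
    rw [← ih]
    exact pathE_tail hstat (n + 1)
      (fun x => g (x (Fin.last n).castSucc) (x (Fin.last n).succ))

lemma pathE_intTrans (hProw : ∀ r, ∑ r', P r r' = 1)
    (hstat : ∀ r', ∑ r, pi r * P r r' = pi r') (u : S → S → ℝ) (n : ℕ) :
    pathE P pi n (fun x => intTrans u n x) = n * mu P pi u := by
  induction n with
  | zero => simp [pathE, intTrans]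
  | succ n ih =>
    simp only [intTrans_succ_eq_init]
    rw [pathE_add, pathE_init hProw n (fun x => intTrans u n x), ih, pathE_last_step hstat u n, mu]
    push_cast
    ring

/-- The integrated transport correlates with the next step through the sum of correlators. -/
lemma pathE_intTrans_mul_last_step (hstat : ∀ r', ∑ r, pi r * P r r' = pi r')
    (u : S → S → ℝ) (n : ℕ) :
    pathE P pi (n + 1) (fun x => intTrans u n (fun i => x i.castSucc)
        * u (x (Fin.last n).castSucc) (x (Fin.last n).succ))
      = ∑ k ∈ Finset.range n, corr P pi u k := by
  induction n with
  | zero => simp [pathE, intTrans]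
  | succ n ih =>
    simp only [intTrans_succ_eq_tail, add_mul]
    rw [pathE_add, Finset.sum_range_succ, ← ih, add_comm]
    congr 1
    exact pathE_tail hstat (n + 1) (fun x => intTrans u n (fun i => x i.castSucc)
      * u (x (Fin.last n).castSucc) (x (Fin.last n).succ))

/-- Increment of the variance of the integrated transport over one step. -/
lemma varS_succ (hProw : ∀ r, ∑ r', P r r' = 1)
    (hstat : ∀ r', ∑ r, pi r * P r r' = pi r') (u : S → S → ℝ) (n : ℕ) :
    varS P pi u (n + 1) = varS P pi u n
      + ((pathE P pi 1 (fun x => (u (x 0) (x 1)) ^ 2) - (mu P pi u) ^ 2)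
        + 2 * ∑ k ∈ Finset.range n, (corr P pi u k - (mu P pi u) ^ 2)) := by
  have hsq : pathE P pi (n + 1) (fun x => (intTrans u (n + 1) x) ^ 2)
      = pathE P pi n (fun x => (intTrans u n x) ^ 2)
        + (2 * ∑ k ∈ Finset.range n, corr P pi u k
          + pathE P pi 1 (fun x => (u (x 0) (x 1)) ^ 2)) := by
    rw [← pathE_init hProw n (fun x => (intTrans u n x) ^ 2),
      ← pathE_intTrans_mul_last_step hstat u n,
      ← pathE_last_step hstat (fun a b => (u a b) ^ 2) n, ← pathE_const_mul, ← pathE_add,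
      ← pathE_add]
    congr 1
    funext x
    rw [intTrans_succ_eq_init]
    ring
  simp only [varS, hsq, pathE_intTrans hProw hstat, Finset.sum_sub_distrib, Finset.sum_const,
    Finset.card_range, nsmul_eq_mul]
  push_cast
  ring

end PathExpectation

/-- Under a finite full mixing time (`C_t = μ²` for all `t ≥ τ*`, `τ* ≥ 1`) and a
bounded variance of the integrated transport,
`Var(u(x₀,x₁)) + 2 ∑_{k=0}^{τ*-1} (C_k - μ²) = 0` and the variance saturates:
`Var(S_τ) = Var(S_{τ*})` for every `τ ≥ τ*`. -/
theorem finite_mixing_variance_saturation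
    {S : Type*} [Fintype S] [Nonempty S]
    (P : S → S → ℝ) (pi : S → ℝ) (u : S → S → ℝ)
    (hP : ∀ r r', 0 ≤ P r r') (hProw : ∀ r, ∑ r', P r r' = 1)
    (hpi : ∀ r, 0 ≤ pi r) (hpisum : ∑ r, pi r = 1)
    (hstat : ∀ r', ∑ r, pi r * P r r' = pi r')
    (τstar : ℕ) (hτstar : 1 ≤ τstar)
    (hmix : ∀ t, τstar ≤ t → corr P pi u t = (mu P pi u) ^ 2)
    (B : ℝ) (hB : ∀ τ : ℕ, varS P pi u τ ≤ B) :
    (pathE P pi 1 (fun x => (u (x 0) (x 1)) ^ 2) - (mu P pi u) ^ 2)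
        + 2 * ∑ k ∈ Finset.range τstar, (corr P pi u k - (mu P pi u) ^ 2) = 0 ∧
    ∀ τ : ℕ, τstar ≤ τ → varS P pi u τ = varS P pi u τstar := by
  have hstep : ∀ n, varS P pi u (τstar + (n + 1)) = varS P pi u (τstar + n)
      + ((pathE P pi 1 (fun x => (u (x 0) (x 1)) ^ 2) - (mu P pi u) ^ 2)
        + 2 * ∑ k ∈ Finset.range τstar, (corr P pi u k - (mu P pi u) ^ 2)) := by
    intro n
    rw [← add_assoc, varS_succ hProw hstat, Finset.sum_range_add,
      Finset.sum_eq_zero (s := Finset.range n)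
        fun k _ => sub_eq_zero.2 (hmix _ (Nat.le_add_right _ _)), add_zero]
  set D := (pathE P pi 1 (fun x => (u (x 0) (x 1)) ^ 2) - (mu P pi u) ^ 2)
    + 2 * ∑ k ∈ Finset.range τstar, (corr P pi u k - (mu P pi u) ^ 2)
  have hlin : ∀ n : ℕ, varS P pi u (τstar + n) = varS P pi u τstar + n * D := by
    intro n
    induction n with
    | zero => simp
    | succ n ih =>
      rw [hstep, ih]
      push_cast
      ring
  have hnonneg : ∀ n, 0 ≤ varS P pi u n := fun n =>
    pathE_sq_sub_sq_nonneg hP hpi hProw hpisum n (fun x => intTrans u n x)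
  have hD : D = 0 := by
    rcases lt_trichotomy D 0 with h | h | h
    · obtain ⟨n, hn⟩ := exists_nat_gt (varS P pi u τstar / -D)
      rw [div_lt_iff₀ (neg_pos.2 h)] at hn
      linarith [hlin n, hnonneg (τstar + n)]
    · exact h
    · obtain ⟨n, hn⟩ := exists_nat_gt ((B - varS P pi u τstar) / D)
      rw [div_lt_iff₀ h] at hn
      linarith [hlin n, hB (τstar + n)]
  refine ⟨hD, fun τ hτ => ?_⟩
  obtain ⟨n, rfl⟩ := Nat.exists_eq_add_of_le hτ
  rw [hlin, hD, mul_zero, add_zero]
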